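/- arXiv:2509.12919 — 3 statements merged into one kernel-verified Lean document; each statement's English description precedes it below -/
import Mathlib

section
/- A real number r ∈ [0,1) admits a finite Cantor expansion (i.e. there exist n ∈ ℕ and integers c_1,…,c_n with 0 ≤ c_k ≤ k for each k and r = Σ_{k=1}^{n} c_k/(k+1)!) if and only if r is rational. Moreover, if r = m/n with natural numbers m, n satisfying n > 0 and 0 ≤ m < n, then r admits a finite Cantor expansion of length strictly less than n. -/
theorem cantor_aux (N : ℕ) : ∀ a : ℕ, a < (N + 1).factorial →
    ∃ c : ℕ → ℕ, (∀ k, 1 ≤ k → k ≤ N → c k ≤ k) ∧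
      (a : ℝ) / ((N + 1).factorial : ℝ)
        = ∑ k ∈ Finset.Icc 1 N, (c k : ℝ) / (Nat.factorial (k + 1)) := by
  induction N with
  | zero =>
    intro a ha
    have : a = 0 := by simpa using ha
    subst this
    exact ⟨fun _ => 0, by simp, by simp⟩
  | succ N ih =>
    intro a ha
    have hlt : a / (N + 2) < (N + 1).factorial := by
      rw [Nat.div_lt_iff_lt_mul (by omega)]
      rw [Nat.factorial_succ (N + 1)] at ha
      linarith
    obtain ⟨c, hc, hs⟩ := ih _ hlt
    refine ⟨fun k => if k = N + 1 then a % (N + 2) else c k, ?_, ?_⟩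
    · intro k h1 h2
      by_cases h : k = N + 1
      · have := Nat.mod_lt a (show N + 2 > 0 by omega)
        simp only [h, if_true]
        omega
      · simp only [h, if_false]
        exact hc k h1 (by omega)
    · rw [Finset.sum_Icc_succ_top (by omega)]
      have e : ∑ k ∈ Finset.Icc 1 N, (((if k = N + 1 then a % (N + 2) else c k : ℕ)) : ℝ) /
          (Nat.factorial (k + 1)) =
          ∑ k ∈ Finset.Icc 1 N, (c k : ℝ) / (Nat.factorial (k + 1)) := by
        apply Finset.sum_congr rfl
        intro k hk
        have := (Finset.mem_Icc.mp hk).2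
        rw [if_neg (by omega)]
      rw [e, ← hs]
      beta_reduce
      rw [if_pos rfl, Nat.factorial_succ (N + 1)]
      have hf : ((N + 1).factorial : ℝ) ≠ 0 := by positivity
      have hN : ((N : ℝ) + 1 + 1) ≠ 0 := by positivity
      have hd : (a : ℝ) = ((N : ℝ) + 1 + 1) * ((a / (N + 2) : ℕ) : ℝ) + ((a % (N + 2) : ℕ) : ℝ) := by
        have := Nat.div_add_mod a (N + 2)
        have h2 : (((N + 2) * (a / (N + 2)) + a % (N + 2) : ℕ) : ℝ) = a := by rw [this]
        rw [← h2]
        push_cast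
        ring
      simp only [Nat.cast_mul, Nat.cast_add, Nat.cast_one]
      generalize ((a / (N + 2) : ℕ) : ℝ) = x at *
      generalize ((a % (N + 2) : ℕ) : ℝ) = y at *
      rw [hd]
      field_simp

theorem cantor_aux2 (r : ℝ) (m n : ℕ) (hn : 0 < n) (hm : m < n) (h : r = (m : ℝ) / (n : ℝ)) :
      ∃ (len : ℕ) (c : ℕ → ℕ), len < n ∧ (∀ k, 1 ≤ k → k ≤ len → c k ≤ k) ∧
        r = ∑ k ∈ Finset.Icc 1 len, (c k : ℝ) / (Nat.factorial (k + 1)) := by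
  obtain ⟨N, rfl⟩ : ∃ N, n = N + 1 := ⟨n - 1, by omega⟩
  obtain ⟨c, hc, hs⟩ := cantor_aux N (m * N.factorial) (by
    rw [Nat.factorial_succ]
    exact Nat.mul_lt_mul_of_pos_right hm (Nat.factorial_pos N))
  refine ⟨N, c, by omega, hc, ?_⟩
  rw [← hs, h, Nat.factorial_succ]
  have hf : (N.factorial : ℝ) ≠ 0 := by positivity
  push_cast
  field_simp

/-- A real `r ∈ [0,1)` admits a finite Cantor expansion
`r = Σ_{k=1}^{n} c_k/(k+1)!` with `0 ≤ c_k ≤ k` iff `r` is rational; and if `r = m/n`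
with `0 ≤ m < n`, then `r` admits such an expansion of length strictly less than `n`. -/
theorem finite_cantor_expansion_iff_rational (r : ℝ) (hr0 : 0 ≤ r) (hr1 : r < 1) :
    ((∃ (n : ℕ) (c : ℕ → ℕ), (∀ k, 1 ≤ k → k ≤ n → c k ≤ k) ∧
        r = ∑ k ∈ Finset.Icc 1 n, (c k : ℝ) / (Nat.factorial (k + 1))) ↔
      ∃ q : ℚ, r = (q : ℝ)) ∧
    (∀ m n : ℕ, 0 < n → m < n → r = (m : ℝ) / (n : ℝ) →
      ∃ (len : ℕ) (c : ℕ → ℕ), len < n ∧ (∀ k, 1 ≤ k → k ≤ len → c k ≤ k) ∧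
        r = ∑ k ∈ Finset.Icc 1 len, (c k : ℝ) / (Nat.factorial (k + 1))) := by
  refine ⟨⟨?_, ?_⟩, fun m n hn hm h => cantor_aux2 r m n hn hm h⟩
  · rintro ⟨n, c, -, h⟩
    exact ⟨∑ k ∈ Finset.Icc 1 n, (c k : ℚ) / (Nat.factorial (k + 1)), by rw [h]; push_cast; rfl⟩
  · rintro ⟨q, h⟩
    have hq0 : 0 ≤ q := by rw [h] at hr0; exact_mod_cast hr0
    have hnum : 0 ≤ q.num := Rat.num_nonneg.mpr hq0
    have hcast : ((q.num.toNat : ℕ) : ℝ) = (q.num : ℝ) := by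
      have := Int.toNat_of_nonneg hnum
      exact_mod_cast this
    have hd : (0 : ℝ) < q.den := by exact_mod_cast q.den_pos
    have hr : r = ((q.num.toNat : ℕ) : ℝ) / (q.den : ℝ) := by
      rw [h, hcast, Rat.cast_def]
    have hlt : q.num.toNat < q.den := by
      rw [hr, div_lt_one hd] at hr1
      exact_mod_cast hr1
    obtain ⟨len, c, -, hc, hs⟩ := cantor_aux2 r _ _ q.den_pos hlt hr
    exact ⟨len, c, hc, hs⟩
end

section
/- Let n ≥ 1 and let α = (α_0, …, α_n) ∈ ℝ^{n+1} have all coordinates strictly positive. Then ∫_{T_n} (∏_{i=0}^{n−1} x_i^{α_i − 1}) · (1 − Σ_{i=0}^{n−1} x_i)^{α_n − 1} dx = (∏_{i=0}^{n} Γ(α_i)) / Γ(Σ_{i=0}^{n} α_i), where T_n = {x ∈ ℝ^n : x_i ≥ 0 for all i, Σ_{i=0}^{n−1} x_i ≤ 1} and the integral is with respect to n-dimensional Lebesgue measure. -/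
open MeasureTheory

/-- The corner simplex `T_n = {x ∈ ℝ^n : x_i ≥ 0, Σ x_i ≤ 1}` parametrizing the
standard `n`-simplex `Δ_n` by its first `n` coordinates. -/
def cornerSimplex (n : ℕ) : Set (Fin n → ℝ) :=
  {x | (∀ i, 0 ≤ x i) ∧ ∑ i, x i ≤ 1}

/-- Integrand on the scaled corner simplex. -/
noncomputable def dirF (n : ℕ) (a : Fin n → ℝ) (b t : ℝ) (x : Fin n → ℝ) : ENNReal :=
  Set.indicator {x : Fin n → ℝ | (∀ i, 0 ≤ x i) ∧ ∑ i, x i ≤ t}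
    (fun x => ENNReal.ofReal ((∏ i, x i ^ (a i - 1)) * (t - ∑ i, x i) ^ (b - 1))) x

lemma beta_one (a b : ℝ) (ha : 0 < a) (hb : 0 < b) :
    ∫⁻ x in Set.Ioo (0:ℝ) 1, ENNReal.ofReal (x ^ (a - 1) * (1 - x) ^ (b - 1))
      = ENNReal.ofReal (ProbabilityTheory.beta a b) := by
  have h := ProbabilityTheory.lintegral_betaPDF_eq_one ha hb
  rw [ProbabilityTheory.lintegral_betaPDF] at h
  have hB := ProbabilityTheory.beta_pos ha hb
  have h2 : ∀ x : ℝ, ENNReal.ofReal (1 / ProbabilityTheory.beta a b * x ^ (a - 1) * (1 - x) ^ (b - 1))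
      = ENNReal.ofReal (1 / ProbabilityTheory.beta a b) *
        ENNReal.ofReal (x ^ (a - 1) * (1 - x) ^ (b - 1)) := by
    intro x
    rw [← ENNReal.ofReal_mul (by positivity), mul_assoc]
  simp_rw [h2] at h
  rw [lintegral_const_mul _ (by fun_prop)] at h
  calc _ = ENNReal.ofReal (ProbabilityTheory.beta a b) * (ENNReal.ofReal (1 / ProbabilityTheory.beta a b) * ∫⁻ x in Set.Ioo (0:ℝ) 1, ENNReal.ofReal (x ^ (a - 1) * (1 - x) ^ (b - 1))) := by
        rw [← mul_assoc, ← ENNReal.ofReal_mul hB.le, mul_one_div_cancel hB.ne']; simp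
    _ = _ := by rw [h, mul_one]

lemma beta_scaled (a b t : ℝ) (ha : 0 < a) (hb : 0 < b) (ht : 0 < t) :
    ∫⁻ x in Set.Ioo (0:ℝ) t, ENNReal.ofReal (x ^ (a - 1) * (t - x) ^ (b - 1))
      = ENNReal.ofReal (ProbabilityTheory.beta a b * t ^ (a + b - 1)) := by
  have himg : (fun x => t * x) '' Set.Ioo (0:ℝ) 1 = Set.Ioo 0 t := by
    rw [Set.image_mul_left_Ioo ht]; simp
  rw [← himg, lintegral_image_eq_lintegral_abs_deriv_mul measurableSet_Ioo (f' := fun _ => t)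
    (fun x _ => by simpa using ((hasDerivAt_id x).const_mul t).hasDerivWithinAt)
    (fun x _ y _ h => mul_left_cancel₀ ht.ne' h)]
  rw [setLIntegral_congr_fun (g := fun x => ENNReal.ofReal (t ^ (a + b - 1)) *
      ENNReal.ofReal (x ^ (a - 1) * (1 - x) ^ (b - 1))) measurableSet_Ioo]
  · rw [lintegral_const_mul _ (by fun_prop), beta_one a b ha hb,
      ← ENNReal.ofReal_mul (by positivity), mul_comm]
  · intro x hx
    have h1 : 0 < 1 - x := by linarith [hx.2]
    simp only
    rw [← ENNReal.ofReal_mul (by positivity), ← ENNReal.ofReal_mul (by positivity), abs_of_pos ht]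
    congr 1
    rw [show t - t * x = t * (1 - x) by ring, Real.mul_rpow ht.le hx.1.le, Real.mul_rpow ht.le h1.le]
    rw [show a + b - 1 = 1 + (a - 1) + (b - 1) by ring, Real.rpow_add ht, Real.rpow_add ht, Real.rpow_one]
    ring

lemma dirSet_meas (n : ℕ) (t : ℝ) :
    MeasurableSet {x : Fin n → ℝ | (∀ i, 0 ≤ x i) ∧ ∑ i, x i ≤ t} := by
  have h1 : MeasurableSet {x : Fin n → ℝ | ∀ i, 0 ≤ x i} := by
    have h : {x : Fin n → ℝ | ∀ i, 0 ≤ x i} = ⋂ i, {x : Fin n → ℝ | 0 ≤ x i} := by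
      ext x; simp
    rw [h]
    exact MeasurableSet.iInter fun i => measurableSet_le measurable_const (measurable_pi_apply i)
  have h2 : MeasurableSet {x : Fin n → ℝ | ∑ i, x i ≤ t} :=
    measurableSet_le (by fun_prop) measurable_const
  exact h1.inter h2

lemma dirF_meas (n : ℕ) (a : Fin n → ℝ) (b t : ℝ) : Measurable (dirF n a b t) := by
  unfold dirF
  exact Measurable.indicator (by fun_prop) (dirSet_meas n t)

lemma dirF_cons (n : ℕ) (a : Fin (n + 1) → ℝ) (b t : ℝ) (u : ℝ) (y : Fin n → ℝ) :
    dirF (n + 1) a b t (Fin.cons u y) =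
      (Set.Icc 0 t).indicator (fun u => ENNReal.ofReal (u ^ (a 0 - 1))) u *
        dirF n (fun i => a i.succ) b (t - u) y := by
  unfold dirF
  by_cases hy : (∀ i, 0 ≤ y i) ∧ ∑ i, y i ≤ t - u
  · have hs : 0 ≤ ∑ i, y i := Finset.sum_nonneg fun i _ => hy.1 i
    rw [Set.indicator_of_mem (show y ∈ {x : Fin n → ℝ | (∀ i, 0 ≤ x i) ∧ ∑ i, x i ≤ t - u} from hy)]
    by_cases hu : 0 ≤ u
    · rw [Set.indicator_of_mem (show u ∈ Set.Icc 0 t from ⟨hu, by linarith [hy.2]⟩),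
        Set.indicator_of_mem, ← ENNReal.ofReal_mul (by positivity)]
      · congr 1
        rw [Fin.prod_univ_succ, Fin.sum_univ_succ]
        simp only [Fin.cons_zero, Fin.cons_succ]
        rw [sub_sub]; ring
      · refine ⟨fun i => ?_, ?_⟩
        · refine Fin.cases ?_ (fun j => ?_) i
          · simpa using hu
          · simpa using hy.1 j
        · rw [Fin.sum_univ_succ]
          simp only [Fin.cons_zero, Fin.cons_succ]
          linarith [hy.2]
    · rw [Set.indicator_of_notMem (show u ∉ Set.Icc 0 t from fun h => hu h.1), Set.indicator_of_notMem, zero_mul]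
      intro h
      exact hu (by simpa using h.1 0)
  · rw [Set.indicator_of_notMem (show y ∉ {x : Fin n → ℝ | (∀ i, 0 ≤ x i) ∧ ∑ i, x i ≤ t - u} from hy), mul_zero,
      Set.indicator_of_notMem]
    intro h
    apply hy
    refine ⟨fun i => by simpa using h.1 i.succ, ?_⟩
    have := h.2
    rw [Fin.sum_univ_succ] at this
    simp only [Fin.cons_zero, Fin.cons_succ] at this
    linarith

lemma dir_main (n : ℕ) : ∀ (a : Fin n → ℝ) (b t : ℝ), (∀ i, 0 < a i) → 0 < b → 0 < t →
    ∫⁻ x, dirF n a b t x = ENNReal.ofReal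
      ((∏ i, Real.Gamma (a i)) * Real.Gamma b / Real.Gamma (∑ i, a i + b)
        * t ^ (∑ i, a i + b - 1)) := by
  induction n with
  | zero =>
    intro a b t ha hb ht
    have := (Real.Gamma_pos_of_pos hb).ne'
    rw [lintegral_unique]
    rw [volume_pi, Measure.pi_of_empty]
    simp [dirF, ht.le, this]
  | succ n ih =>
    intro a b t ha hb ht
    rw [← (volume_preserving_piFinSuccAbove (fun _ : Fin (n + 1) => ℝ) 0).symm.lintegral_comp
      (dirF_meas _ a b t)]
    rw [Measure.volume_eq_prod, lintegral_prod _ (Measurable.aemeasurable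
      ((dirF_meas _ a b t).fun_comp (MeasurableEquiv.measurable _)))]
    have hcons : ∀ (u : ℝ) (y : Fin n → ℝ),
        (MeasurableEquiv.piFinSuccAbove (fun _ : Fin (n + 1) => ℝ) 0).symm (u, y)
          = Fin.cons u y := by
      intro u y
      simp [MeasurableEquiv.piFinSuccAbove]
      rfl
    simp_rw [hcons, dirF_cons]
    set s := ∑ i : Fin n, a i.succ + b with hs
    have hspos : 0 < s := by
      have : 0 ≤ ∑ i : Fin n, a i.succ := Finset.sum_nonneg fun i _ => (ha _).le
      linarith
    set C := (∏ i : Fin n, Real.Gamma (a i.succ)) * Real.Gamma b / Real.Gamma s with hC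
    have hC0 : 0 ≤ C := by
      have h1 : 0 ≤ ∏ i : Fin n, Real.Gamma (a i.succ) :=
        Finset.prod_nonneg fun i _ => (Real.Gamma_pos_of_pos (ha _)).le
      have h2 := Real.Gamma_pos_of_pos hb
      have h3 := Real.Gamma_pos_of_pos hspos
      positivity
    have hstep : ∀ᵐ u : ℝ, (∫⁻ y, (Set.Icc 0 t).indicator
          (fun u => ENNReal.ofReal (u ^ (a 0 - 1))) u *
        dirF n (fun i => a i.succ) b (t - u) y) =
        (Set.Ioo 0 t).indicator (fun u => ENNReal.ofReal C *
          ENNReal.ofReal (u ^ (a 0 - 1) * (t - u) ^ (s - 1))) u := by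
      filter_upwards [Measure.ae_ne volume (0:ℝ), Measure.ae_ne volume t] with u h0 h1
      rw [lintegral_const_mul _ (dirF_meas _ _ _ _)]
      by_cases hu : u ∈ Set.Ioo 0 t
      · have hu1 := hu.1
        have hu2 : 0 < t - u := by linarith [hu.2]
        rw [Set.indicator_of_mem hu, Set.indicator_of_mem (Set.Ioo_subset_Icc_self hu),
          ih _ _ _ (fun i => ha _) hb hu2, ← ENNReal.ofReal_mul (by positivity),
          ← ENNReal.ofReal_mul hC0]
        congr 1
        ring
      · rw [Set.indicator_of_notMem hu, Set.indicator_of_notMem, zero_mul]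
        intro h
        exact hu ⟨lt_of_le_of_ne h.1 (Ne.symm h0), lt_of_le_of_ne h.2 h1⟩
    rw [lintegral_congr_ae hstep, lintegral_indicator measurableSet_Ioo,
      lintegral_const_mul _ (by fun_prop), beta_scaled _ _ _ (ha 0) hspos ht,
      ← ENNReal.ofReal_mul hC0]
    congr 1
    have h3 := (Real.Gamma_pos_of_pos hspos).ne'
    rw [Fin.prod_univ_succ, Fin.sum_univ_succ, hC, ProbabilityTheory.beta, add_assoc, ← hs]
    field_simp

/-- For `n ≥ 1` and `α ∈ ℝ^{n+1}` with all coordinates positive,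
`∫_{T_n} (∏_{i<n} x_i^{α_i−1}) (1 − Σ_{i<n} x_i)^{α_n−1} dx
  = (∏_{i=0}^n Γ(α_i)) / Γ(Σ_{i=0}^n α_i)`,
the integral being with respect to `n`-dimensional Lebesgue measure. -/
theorem dirichlet_normalization (n : ℕ) (hn : 1 ≤ n)
    (α : Fin (n + 1) → ℝ) (hα : ∀ i, 0 < α i) :
    ∫ x in cornerSimplex n,
        (∏ i : Fin n, x i ^ (α i.castSucc - 1)) * (1 - ∑ i, x i) ^ (α (Fin.last n) - 1)
      = (∏ i, Real.Gamma (α i)) / Real.Gamma (∑ i, α i) := by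
  have hm := dir_main n (fun i => α i.castSucc) (α (Fin.last n)) 1 (fun i => hα _) (hα _) one_pos
  have hS : MeasurableSet (cornerSimplex n) := dirSet_meas n 1
  have hm2 : ∫⁻ x in cornerSimplex n, ENNReal.ofReal
      ((∏ i : Fin n, x i ^ (α i.castSucc - 1)) * (1 - ∑ i, x i) ^ (α (Fin.last n) - 1)) =
      ∫⁻ x, dirF n (fun i => α i.castSucc) (α (Fin.last n)) 1 x := by
    rw [← lintegral_indicator hS]
    rfl
  rw [integral_eq_lintegral_of_nonneg_ae, hm2, hm, ENNReal.toReal_ofReal]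
  · rw [Fin.prod_univ_castSucc, Fin.sum_univ_castSucc]
    simp
  · have h1 : 0 ≤ ∏ i : Fin n, Real.Gamma (α i.castSucc) :=
      Finset.prod_nonneg fun i _ => (Real.Gamma_pos_of_pos (hα _)).le
    have h2 := Real.Gamma_pos_of_pos (hα (Fin.last n))
    have h4 : 0 ≤ ∑ i : Fin n, α i.castSucc := Finset.sum_nonneg fun i _ => (hα _).le
    have h3 := Real.Gamma_pos_of_pos (add_pos_of_nonneg_of_pos h4 (hα (Fin.last n)))
    positivity
  · filter_upwards [ae_restrict_mem hS] with x hx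
    exact mul_nonneg (Finset.prod_nonneg fun i _ => Real.rpow_nonneg (hx.1 i) _)
      (Real.rpow_nonneg (by linarith [hx.2]) _)
  · exact Measurable.aestronglyMeasurable (by fun_prop)
end

section
/- Let n ≥ 1, let α = (α_0, …, α_n) ∈ ℝ^{n+1} have all coordinates strictly positive, let 0 < ℓ ≤ n, and let 0 ≤ r_0 < r_1 < ⋯ < r_{ℓ−1} < r_ℓ = n be integers. Define the grouping map A : Δ_n → Δ_ℓ by A(x)_0 = Σ_{k=0}^{r_0} x_k and A(x)_j = Σ_{k=r_{j−1}+1}^{r_j} x_k for 1 ≤ j ≤ ℓ. Then the pushforward of the Dirichlet measure μ_α on Δ_n under A is the Dirichlet measure μ_β on Δ_ℓ, where β_0 = Σ_{k=0}^{r_0} α_k and β_j = Σ_{k=r_{j−1}+1}^{r_j} α_k for 1 ≤ j ≤ ℓ. -/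
open MeasureTheory

/-- Parametrization `T_n → Δ_n ⊆ ℝ^{n+1}`, `x ↦ (x_0,…,x_{n−1}, 1 − Σ_{i<n} x_i)`. -/
noncomputable def toSimplex {n : ℕ} (x : Fin n → ℝ) : Fin (n + 1) → ℝ :=
  Fin.snoc x (1 - ∑ i, x i)

/-- The Dirichlet measure `μ_α` on the standard `n`-simplex `Δ_n ⊆ ℝ^{n+1}`: the pushforward
under the parametrization `toSimplex` of the measure on `T_n` with density
`b_n(x,α)/B_n(α)` with respect to `n`-dimensional Lebesgue measure. -/
noncomputable def dirichletMeasure (n : ℕ) (α : Fin (n + 1) → ℝ) :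
    Measure (Fin (n + 1) → ℝ) :=
  Measure.map toSimplex
    ((volume.restrict (cornerSimplex n)).withDensity fun x =>
      ENNReal.ofReal
        (((∏ i : Fin n, x i ^ (α i.castSucc - 1)) * (1 - ∑ i, x i) ^ (α (Fin.last n) - 1)) /
          ((∏ i, Real.Gamma (α i)) / Real.Gamma (∑ i, α i))))

/-- Lower endpoint of the `j`-th index group determined by `r`: `0` for `j = 0`
and `r_{j−1} + 1` for `j ≥ 1`. -/
def groupLo (r : ℕ → ℕ) (j : ℕ) : ℕ := if j = 0 then 0 else r (j - 1) + 1

/-- The grouping map `A : ℝ^{n+1} → ℝ^{ℓ+1}` determined by `0 ≤ r_0 < ⋯ < r_ℓ = n`: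
`A(x)_0 = Σ_{k=0}^{r_0} x_k` and `A(x)_j = Σ_{k=r_{j−1}+1}^{r_j} x_k` for `1 ≤ j ≤ ℓ`. -/
noncomputable def groupMap (n ℓ : ℕ) (r : ℕ → ℕ) (x : Fin (n + 1) → ℝ) :
    Fin (ℓ + 1) → ℝ :=
  fun j => ∑ i : Fin (n + 1),
    if groupLo r (j : ℕ) ≤ (i : ℕ) ∧ (i : ℕ) ≤ r (j : ℕ) then x i else 0


open ProbabilityTheory

lemma lintegral_pi_prod' (m : ℕ) (f : Fin m → ℝ → ENNReal) (hf : ∀ i, Measurable (f i)) :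
    ∫⁻ x : Fin m → ℝ, ∏ i, f i (x i) = ∏ i, ∫⁻ t, f i t := by
  induction m with
  | zero => simp [volume_pi, Measure.pi_empty_univ]
  | succ m ih =>
    rw [← (volume_preserving_piFinSuccAbove (fun _ : Fin (m+1) => ℝ) 0).symm.lintegral_comp
      (by fun_prop)]
    simp only [MeasurableEquiv.piFinSuccAbove_symm_apply, Fin.insertNthEquiv,
        Fin.prod_univ_succ, Fin.insertNth_zero]
    have := ih (fun i => f i.succ) (fun i => hf _)
    rw [← this, ← lintegral_prod_mul (hf 0).aemeasurable
      (Finset.measurable_prod _ fun i _ => (hf i.succ).comp (measurable_pi_apply i)).aemeasurable]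
    rfl

lemma pi_withDensity' (m : ℕ) (f : Fin m → ℝ → ENNReal) (hf : ∀ i, Measurable (f i))
    [∀ i, SigmaFinite ((volume : Measure ℝ).withDensity (f i))] :
    Measure.pi (fun i => (volume : Measure ℝ).withDensity (f i))
      = (volume : Measure (Fin m → ℝ)).withDensity (fun x => ∏ i, f i (x i)) := by
  refine Measure.pi_eq fun s hs => ?_
  rw [withDensity_apply _ (.univ_pi hs), ← lintegral_indicator (.univ_pi hs)]
  simp_rw [withDensity_apply _ (hs _), ← lintegral_indicator (hs _)]
  rw [← lintegral_pi_prod' _ _ (fun i => (hf i).indicator (hs i))]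
  congr 1
  ext x
  by_cases hx : x ∈ Set.univ.pi s
  · rw [Set.indicator_of_mem hx]
    refine Finset.prod_congr rfl fun i _ => ?_
    rw [Set.indicator_of_mem (hx i trivial)]
  · rw [Set.indicator_of_notMem hx]
    simp only [Set.mem_pi, Set.mem_univ, true_imp_iff, not_forall] at hx
    obtain ⟨i, hi⟩ := hx
    exact (Finset.prod_eq_zero (Finset.mem_univ i) (Set.indicator_of_notMem hi _)).symm

lemma lintegral_snoc (n : ℕ) (K : (Fin (n+1) → ℝ) → ENNReal) (hK : Measurable K) :
    ∫⁻ y, K y = ∫⁻ s : ℝ, ∫⁻ x : Fin n → ℝ, K (Fin.snoc x (s - ∑ i, x i)) := by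
  have hm : Measurable (fun p : ℝ × (Fin n → ℝ) => (Fin.snoc p.2 p.1 : Fin (n+1) → ℝ)) := by
    refine measurable_pi_iff.2 fun i => ?_
    refine Fin.lastCases ?_ (fun j => ?_) i
    · simpa using measurable_fst
    · simp only [Fin.snoc_castSucc]; fun_prop
  rw [← (volume_preserving_piFinSuccAbove (fun _ : Fin (n+1) => ℝ) (Fin.last n)).symm.lintegral_comp
      hK]
  have h1 : ∀ p : ℝ × (Fin n → ℝ), (MeasurableEquiv.piFinSuccAbove (fun _ : Fin (n+1) => ℝ)
      (Fin.last n)).symm p = (Fin.snoc p.2 p.1 : Fin (n+1) → ℝ) := by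
    intro p
    simp only [MeasurableEquiv.piFinSuccAbove_symm_apply, Fin.insertNthEquiv]
    exact Fin.insertNth_last' _ _
  calc _ = ∫⁻ p : ℝ × (Fin n → ℝ), K (Fin.snoc p.2 p.1) := by
        refine lintegral_congr fun p => ?_
        rw [h1]
    _ = ∫⁻ x : Fin n → ℝ, ∫⁻ t : ℝ, K (Fin.snoc x t) := by
        rw [Measure.volume_eq_prod]
        exact lintegral_prod_symm' _ (hK.comp hm)
    _ = ∫⁻ x : Fin n → ℝ, ∫⁻ s : ℝ, K (Fin.snoc x (s - ∑ i, x i)) := by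
        refine lintegral_congr fun x => ?_
        exact (lintegral_sub_right_eq_self (fun t => K (Fin.snoc x t)) _).symm
    _ = _ := by
        rw [lintegral_lintegral_swap]
        refine Measurable.aemeasurable ?_
        exact (hK.comp hm).comp (f := fun p : (Fin n → ℝ) × ℝ => (p.2 - ∑ i, p.1 i, p.1))
          (by fun_prop)

lemma lintegral_scale (n : ℕ) (s : ℝ) (hs : 0 < s) (φ : (Fin n → ℝ) → ENNReal)
    (hφ : Measurable φ) :
    ∫⁻ x, φ x = ENNReal.ofReal (s ^ n) * ∫⁻ u, φ (s • u) := by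
  have h := Measure.map_addHaar_smul (volume : Measure (Fin n → ℝ)) hs.ne'
  rw [← lintegral_map hφ (measurable_const_smul s), h, lintegral_smul_measure, smul_eq_mul,
    ← mul_assoc, ← ENNReal.ofReal_mul (by positivity), abs_of_pos (by positivity)]
  simp [hs.ne']

lemma measurable_toSimplex (n : ℕ) : Measurable (toSimplex : (Fin n → ℝ) → _) := by
  refine measurable_pi_iff.2 fun i => ?_
  unfold toSimplex
  refine Fin.lastCases ?_ (fun j => ?_) i
  · simp only [Fin.snoc_last]; fun_prop
  · simpa using (measurable_pi_apply j)

lemma sum_toSimplex {n : ℕ} (u : Fin n → ℝ) : ∑ i, toSimplex u i = 1 := by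
  simp [Fin.sum_univ_castSucc, toSimplex]

lemma snoc_smul {n : ℕ} (s : ℝ) (u : Fin n → ℝ) :
    (Fin.snoc (s • u) (s - ∑ i, (s • u) i) : Fin (n+1) → ℝ) = s • toSimplex u := by
  ext i
  refine Fin.lastCases ?_ (fun j => ?_) i
  · simp [toSimplex, ← Finset.mul_sum]; ring
  · simp [toSimplex]

lemma mem_corner_iff {n : ℕ} (u : Fin n → ℝ) :
    u ∈ cornerSimplex n ↔ ∀ i, 0 ≤ toSimplex u i := by
  simp [cornerSimplex, Fin.forall_fin_succ', toSimplex]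

lemma measurableSet_corner (n : ℕ) : MeasurableSet (cornerSimplex n) := by
  have : cornerSimplex n = ⋂ i, {u | 0 ≤ toSimplex u i} := by
    ext u; simp [mem_corner_iff]
  rw [this]
  refine MeasurableSet.iInter fun i => ?_
  exact measurableSet_le measurable_const ((measurable_pi_apply i).comp (measurable_toSimplex n))

/-- Dirichlet density -/
noncomputable def dirDens (n : ℕ) (α : Fin (n+1) → ℝ) (x : Fin n → ℝ) : ENNReal :=
  (cornerSimplex n).indicator (fun x => ENNReal.ofReal
        (((∏ i : Fin n, x i ^ (α i.castSucc - 1)) * (1 - ∑ i, x i) ^ (α (Fin.last n) - 1)) /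
          ((∏ i, Real.Gamma (α i)) / Real.Gamma (∑ i, α i)))) x

lemma measurable_dirDens (n : ℕ) (α : Fin (n+1) → ℝ) : Measurable (dirDens n α) := by
  unfold dirDens
  refine Measurable.indicator ?_ (measurableSet_corner n)
  fun_prop

lemma lintegral_dirichlet (n : ℕ) (α : Fin (n+1) → ℝ) (F : (Fin (n+1) → ℝ) → ENNReal)
    (hF : Measurable F) :
    ∫⁻ v, F v ∂(dirichletMeasure n α) = ∫⁻ u, dirDens n α u * F (toSimplex u) := by
  unfold dirichletMeasure
  rw [lintegral_map hF (measurable_toSimplex n), ← withDensity_indicator (measurableSet_corner n)]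
  exact lintegral_withDensity_eq_lintegral_mul _ (measurable_dirDens n α)
    (hF.comp (measurable_toSimplex n))

lemma measurable_gammaPDF' (a r : ℝ) : Measurable (gammaPDF a r) :=
  (measurable_gammaPDFReal a r).ennreal_ofReal

lemma dens_identity (n : ℕ) (α : Fin (n+1) → ℝ) (hα : ∀ i, 0 < α i) (s : ℝ) (hs : 0 < s)
    (u : Fin n → ℝ) :
    ENNReal.ofReal (s ^ n) * ∏ i, gammaPDF (α i) 1 ((s • toSimplex u) i)
      = gammaPDF (∑ i, α i) 1 s * dirDens n α u := by
  by_cases hu : u ∈ cornerSimplex n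
  · have hv := (mem_corner_iff u).1 hu
    have hA : 0 < ∑ i, α i := Finset.sum_pos (fun i _ => hα i) Finset.univ_nonempty
    have hG : 0 < Real.Gamma (∑ i, α i) := Real.Gamma_pos_of_pos hA
    have hGi : ∀ i, 0 < Real.Gamma (α i) := fun i => Real.Gamma_pos_of_pos (hα i)
    have hP : 0 < ∏ i, Real.Gamma (α i) := Finset.prod_pos fun i _ => hGi i
    rw [dirDens, Set.indicator_of_mem hu, gammaPDF_of_nonneg hs.le,
      ← ENNReal.ofReal_mul (by positivity)]
    have h1 : ∀ i, gammaPDF (α i) 1 ((s • toSimplex u) i) =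
        ENNReal.ofReal ((Real.Gamma (α i))⁻¹ * (s ^ (α i - 1) * toSimplex u i ^ (α i - 1)) *
          Real.exp (-(s * toSimplex u i))) := by
      intro i
      rw [gammaPDF_of_nonneg (by simpa using mul_nonneg hs.le (hv i))]
      simp [Real.mul_rpow hs.le (hv i)]
    simp_rw [h1]
    rw [← ENNReal.ofReal_prod_of_nonneg, ← ENNReal.ofReal_mul (by positivity)]
    · congr 1
      simp_rw [Finset.prod_mul_distrib]
      rw [← Real.exp_sum, Finset.sum_neg_distrib, ← Finset.mul_sum, sum_toSimplex]
      have h2 : ∏ i, s ^ (α i - 1) = s ^ (∑ i, α i - 1) / s ^ n := by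
        rw [← Real.rpow_sum_of_pos hs, Finset.sum_sub_distrib]
        simp only [Finset.sum_const, Finset.card_univ, Fintype.card_fin, nsmul_eq_mul]
        rw [← Real.rpow_natCast s n, ← Real.rpow_sub hs]
        push_cast
        ring_nf
      have h3 : ∏ i, toSimplex u i ^ (α i - 1) =
        ((∏ i : Fin n, u i ^ (α i.castSucc - 1)) * (1 - ∑ i, u i) ^ (α (Fin.last n) - 1)) := by
        rw [Fin.prod_univ_castSucc]
        simp [toSimplex]
      rw [h2, h3, Finset.prod_inv_distrib]
      simp only [Real.one_rpow, one_mul, mul_one]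
      field_simp
    · intro i _
      have := hGi i
      have := Real.rpow_nonneg (hv i) (α i - 1)
      positivity
  · rw [dirDens, Set.indicator_of_notMem hu, mul_zero]
    rw [mem_corner_iff] at hu
    push Not at hu
    obtain ⟨i, hi⟩ := hu
    rw [Finset.prod_eq_zero (Finset.mem_univ i), mul_zero]
    exact gammaPDF_of_neg (by simpa using mul_neg_of_pos_of_neg hs hi)

/-- product gamma -/
noncomputable def prodGamma {ι : Type*} [Fintype ι] (α : ι → ℝ) : Measure (ι → ℝ) :=
  Measure.pi fun i => gammaMeasure (α i) 1

lemma core (n : ℕ) (α : Fin (n+1) → ℝ) (hα : ∀ i, 0 < α i)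
    (F : ℝ → (Fin (n+1) → ℝ) → ENNReal) (hF : Measurable (Function.uncurry F)) :
    ∫⁻ y, F (∑ i, y i) ((∑ i, y i)⁻¹ • y) ∂(prodGamma α)
      = ∫⁻ s, ∫⁻ v, F s v ∂(dirichletMeasure n α) ∂(gammaMeasure (∑ i, α i) 1) := by
  have hp : ∀ i, IsProbabilityMeasure ((volume : Measure ℝ).withDensity (gammaPDF (α i) 1)) :=
    fun i => isProbabilityMeasure_gammaMeasure (hα i) one_pos
  have hg : ∀ a r, Measurable (gammaPDF a r) := measurable_gammaPDF'
  have hFm : Measurable fun y : Fin (n+1) → ℝ => F (∑ i, y i) ((∑ i, y i)⁻¹ • y) :=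
    hF.comp (f := fun y : Fin (n+1) → ℝ => (∑ i, y i, (∑ i, y i)⁻¹ • y)) (by fun_prop)
  have hFs : ∀ s, Measurable (F s) := fun s => hF.comp measurable_prodMk_left
  have hGm : Measurable fun y : Fin (n+1) → ℝ => ∏ i, gammaPDF (α i) 1 (y i) := by
    refine Finset.measurable_prod _ fun i _ => (hg _ _).comp (measurable_pi_apply i)
  unfold prodGamma gammaMeasure
  rw [pi_withDensity' _ _ (fun i => hg _ _),
    lintegral_withDensity_eq_lintegral_mul _ hGm hFm, lintegral_snoc _ _ (hGm.mul hFm)]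
  have hin : ∀ s, ∫⁻ v, F s v ∂(dirichletMeasure n α)
      = ∫⁻ u, dirDens n α u * F s (toSimplex u) := fun s => lintegral_dirichlet _ _ _ (hFs s)
  simp_rw [hin]
  rw [lintegral_withDensity_eq_lintegral_mul _ (hg _ _)]
  swap
  · refine Measurable.lintegral_prod_right' (f := fun p : ℝ × (Fin n → ℝ) =>
      dirDens n α p.2 * F p.1 (toSimplex p.2)) ?_
    refine ((measurable_dirDens n α).comp measurable_snd).mul ?_
    exact hF.comp (measurable_fst.prodMk ((measurable_toSimplex n).comp measurable_snd))
  refine lintegral_congr_ae ?_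
  have h0 : ∀ᵐ s : ℝ, s ≠ 0 := by simp [ae_iff]
  filter_upwards [h0] with s hs0
  rcases lt_or_gt_of_ne hs0 with hs | hs
  · simp only [Pi.mul_apply, gammaPDF_of_neg hs, zero_mul]
    rw [lintegral_eq_zero_of_ae_eq_zero]
    refine Filter.Eventually.of_forall fun x => ?_
    set y : Fin (n+1) → ℝ := Fin.snoc x (s - ∑ i, x i) with hy
    have hsum : ∑ i, y i = s := by simp [hy, Fin.sum_univ_castSucc]
    have : ∃ i, y i < 0 := by
      by_contra! h
      have := Finset.sum_nonneg (fun i (_ : i ∈ Finset.univ) => h i)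
      linarith
    obtain ⟨i, hi⟩ := this
    show (∏ i, gammaPDF (α i) 1 (y i)) * _ = 0
    rw [Finset.prod_eq_zero (Finset.mem_univ i) (gammaPDF_of_neg hi), zero_mul]
  · have hmeas : Measurable fun x : Fin n → ℝ => (Fin.snoc x (s - ∑ i, x i) : Fin (n+1) → ℝ) := by
      refine measurable_pi_iff.2 fun i => ?_
      refine Fin.lastCases ?_ (fun j => ?_) i
      · simp only [Fin.snoc_last]; fun_prop
      · simpa using (measurable_pi_apply j)
    refine (lintegral_scale n s hs _ ((hGm.mul hFm).comp hmeas)).trans ?_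
    simp only [Function.comp, Pi.mul_apply, snoc_smul]
    rw [← lintegral_const_mul' _ _ ENNReal.ofReal_ne_top, ← lintegral_const_mul']
    swap
    · simp [gammaPDF]
    refine lintegral_congr fun u => ?_
    have hsum : ∑ i, (s • toSimplex u) i = s := by
      simp [← Finset.mul_sum, sum_toSimplex]
    rw [hsum, inv_smul_smul₀ hs.ne', ← mul_assoc, ← mul_assoc, dens_identity n α hα s hs]

lemma prodGamma_prob {ι : Type*} [Fintype ι] (α : ι → ℝ) (hα : ∀ i, 0 < α i) :
    IsProbabilityMeasure (prodGamma α) := by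
  have hp : ∀ i, IsProbabilityMeasure (gammaMeasure (α i) 1) :=
    fun i => isProbabilityMeasure_gammaMeasure (hα i) one_pos
  unfold prodGamma; infer_instance

lemma dirichlet_univ (n : ℕ) (α : Fin (n+1) → ℝ) (hα : ∀ i, 0 < α i) :
    dirichletMeasure n α Set.univ = 1 := by
  have h := core n α hα (fun _ _ => 1) (by fun_prop)
  have := prodGamma_prob α hα
  have := isProbabilityMeasure_gammaMeasure (a := ∑ i, α i) (r := 1)
    (Finset.sum_pos (fun i _ => hα i) Finset.univ_nonempty) one_pos
  simpa using h.symm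

lemma dirichlet_eq_map (n : ℕ) (α : Fin (n+1) → ℝ) (hα : ∀ i, 0 < α i) :
    dirichletMeasure n α = (prodGamma α).map fun y => (∑ i, y i)⁻¹ • y := by
  have := isProbabilityMeasure_gammaMeasure (a := ∑ i, α i) (r := 1)
    (Finset.sum_pos (fun i _ => hα i) Finset.univ_nonempty) one_pos
  have hm : Measurable fun y : Fin (n+1) → ℝ => (∑ i, y i)⁻¹ • y := by fun_prop
  refine Measure.ext_of_lintegral _ fun f hf => ?_
  rw [lintegral_map hf hm, core n α hα (fun _ v => f v) (hf.comp measurable_snd)]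
  simp

lemma sum_prodGamma_fin (n : ℕ) (α : Fin (n+1) → ℝ) (hα : ∀ i, 0 < α i) :
    (prodGamma α).map (fun y => ∑ i, y i) = gammaMeasure (∑ i, α i) 1 := by
  refine Measure.ext_of_lintegral _ fun f hf => ?_
  rw [lintegral_map hf (by fun_prop), core n α hα (fun s _ => f s) (hf.comp measurable_fst)]
  simp [dirichlet_univ n α hα]

lemma sum_prodGamma {ι : Type*} [Fintype ι] [Nonempty ι] (α : ι → ℝ) (hα : ∀ i, 0 < α i) :
    (prodGamma α).map (fun y => ∑ i, y i) = gammaMeasure (∑ i, α i) 1 := by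
  obtain ⟨n, hn⟩ := Nat.exists_eq_succ_of_ne_zero (Fintype.card_ne_zero (α := ι))
  have e : Fin (n+1) ≃ ι := (Fintype.equivFinOfCardEq hn).symm
  have hp : ∀ i, IsProbabilityMeasure (gammaMeasure (α i) 1) :=
    fun i => isProbabilityMeasure_gammaMeasure (hα i) one_pos
  have h1 := (measurePreserving_piCongrLeft (fun i => gammaMeasure (α i) 1) e).map_eq
  have h2 := sum_prodGamma_fin n (fun i => α (e i)) (fun i => hα _)
  rw [e.sum_comp] at h2
  rw [← h2]
  unfold prodGamma
  rw [← h1, Measure.map_map (by fun_prop) (by fun_prop)]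
  congr 1
  ext y
  simp only [Function.comp]
  rw [← e.sum_comp]
  refine Finset.sum_congr rfl fun i _ => ?_
  exact Equiv.piCongrLeft_apply_apply (fun _ => ℝ) e y i

lemma prodGamma_group {ι κ : Type*} [Fintype ι] [Fintype κ] [DecidableEq κ] (g : ι → κ)
    (hg : Function.Surjective g) (α : ι → ℝ) (hα : ∀ i, 0 < α i) :
    (prodGamma α).map (fun y j => ∑ i : {i // g i = j}, y i)
      = prodGamma fun j => ∑ i : {i // g i = j}, α i := by
  have hp : ∀ i, IsProbabilityMeasure (gammaMeasure (α i) 1) :=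
    fun i => isProbabilityMeasure_gammaMeasure (hα i) one_pos
  have hne : ∀ j, Nonempty {i // g i = j} := fun j => ⟨⟨_, (hg j).choose_spec⟩⟩
  have hpp : ∀ j, IsProbabilityMeasure (prodGamma fun i : {i // g i = j} => α i) :=
    fun j => prodGamma_prob _ fun i => hα _
  have key : prodGamma α = (Measure.pi fun j => prodGamma fun i : {i // g i = j} => α i).map
      (fun y i => y (g i) ⟨i, rfl⟩) := by
    have hm : Measurable (fun (y : ∀ j, {i // g i = j} → ℝ) (i : ι) => y (g i) ⟨i, rfl⟩) := by
      fun_prop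
    refine Measure.pi_eq fun s hs => ?_
    rw [Measure.map_apply hm (.univ_pi hs)]
    have : (fun (y : ∀ j, {i // g i = j} → ℝ) (i : ι) => y (g i) ⟨i, rfl⟩) ⁻¹' Set.univ.pi s
        = Set.univ.pi fun j => Set.univ.pi fun i : {i // g i = j} => s i := by
      ext y
      simp only [Set.mem_preimage, Set.mem_pi, Set.mem_univ, true_imp_iff]
      exact ⟨fun h j i => by obtain ⟨i, rfl⟩ := i; exact h i, fun h i => h _ ⟨i, rfl⟩⟩
    rw [this, Measure.pi_pi]
    unfold prodGamma
    simp_rw [Measure.pi_pi]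
    exact Fintype.prod_fiberwise g (fun i => gammaMeasure (α i) 1 (s i))
  rw [key, Measure.map_map (by fun_prop) (by fun_prop)]
  have hsum := fun j => sum_prodGamma (fun i : {i // g i = j} => α i) (fun i => hα _)
  have hs' : ∀ j, IsProbabilityMeasure ((prodGamma fun i : {i // g i = j} => α i).map
      (fun y => ∑ i, y i)) := fun j => Measure.isProbabilityMeasure_map (by fun_prop)
  have h3 := Measure.pi_map_pi (μ := fun j => prodGamma fun i : {i // g i = j} => α i)
    (f := fun j (y : {i // g i = j} → ℝ) => ∑ i, y i) (fun j => by fun_prop)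
  simp_rw [hsum] at h3
  rw [prodGamma, ← h3]
  congr 1
  ext y j
  refine Finset.sum_congr rfl fun i _ => ?_
  obtain ⟨i, rfl⟩ := i
  rfl

lemma block_unique (n ℓ : ℕ) (r : ℕ → ℕ) (hr : ∀ j, j < ℓ → r j < r (j + 1)) (hrl : r ℓ = n)
    (i : Fin (n+1)) :
    ∃ j : Fin (ℓ+1), ∀ k : Fin (ℓ+1),
      (groupLo r (k : ℕ) ≤ (i : ℕ) ∧ (i : ℕ) ≤ r (k : ℕ)) ↔ j = k := by
  have hmono : ∀ b, b ≤ ℓ → ∀ a, a ≤ b → r a ≤ r b := by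
    intro b
    induction b with
    | zero => intro _ a ha; simp [Nat.le_zero.1 ha]
    | succ b ih =>
      intro hb a ha
      rcases Nat.lt_or_ge b a with h | h
      · have : a = b + 1 := by omega
        rw [this]
      · have := ih (by omega) a h
        have := hr b (by omega)
        omega
  have hex : ∃ j, (i : ℕ) ≤ r j := ⟨ℓ, by have := i.2; omega⟩
  classical
  have hspec := Nat.find_spec hex
  have hmin := fun m (h : m < Nat.find hex) => Nat.find_min hex h
  have hle : Nat.find hex ≤ ℓ := Nat.find_min' hex (by have := i.2; omega)
  set j := Nat.find hex
  refine ⟨⟨j, by omega⟩, fun k => ⟨fun ⟨h1, h2⟩ => ?_, ?_⟩⟩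
  · have hjk : j ≤ k := Nat.find_min' hex h2
    ext
    by_contra hne
    have hlt : j < k := lt_of_le_of_ne hjk hne
    have hk := k.2
    have := hmono (k - 1) (by omega) j (by omega)
    unfold groupLo at h1
    rw [if_neg (by omega)] at h1
    omega
  · rintro rfl
    refine ⟨?_, hspec⟩
    unfold groupLo
    split_ifs with h
    · exact Nat.zero_le _
    · have := hmin (j - 1) (by simp only at h; omega)
      simp only
      omega

/-- For `n ≥ 1`, `α ∈ ℝ^{n+1}` with all coordinates positive,
`0 < ℓ ≤ n` and integers `0 ≤ r_0 < r_1 < ⋯ < r_{ℓ−1} < r_ℓ = n`, the pushforward of the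
Dirichlet measure `μ_α` on `Δ_n` under the grouping map `A` is the Dirichlet measure `μ_β`
on `Δ_ℓ`, where `β` is obtained by applying the same grouping to the parameter `α`. -/
theorem dirichlet_map_group (n ℓ : ℕ) (hn : 1 ≤ n) (hℓ : 0 < ℓ) (hℓn : ℓ ≤ n)
    (α : Fin (n + 1) → ℝ) (hα : ∀ i, 0 < α i)
    (r : ℕ → ℕ) (hr : ∀ j, j < ℓ → r j < r (j + 1)) (hrl : r ℓ = n) :
    Measure.map (groupMap n ℓ r) (dirichletMeasure n α)
      = dirichletMeasure ℓ (groupMap n ℓ r α) := by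
  choose g hg using block_unique n ℓ r hr hrl
  have hmap : ∀ x, groupMap n ℓ r x = fun j => ∑ i : {i // g i = j}, x i := by
    intro x
    ext j
    unfold groupMap
    simp_rw [hg]
    rw [← Finset.sum_filter]
    exact (Finset.sum_subtype _ (by simp) _)
  have hle : ∀ j, j ≤ ℓ → r j ≤ n := by
    intro j hj
    induction hk : ℓ - j generalizing j with
    | zero => have : j = ℓ := by omega
              rw [this, hrl]
    | succ k ih =>
      have := ih (j+1) (by omega) (by omega)
      have := hr j (by omega)
      omega
  have hsurj : Function.Surjective g := by
    intro j
    refine ⟨⟨r j, by have := hle j (by omega); omega⟩, ?_⟩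
    rw [← hg]
    refine ⟨?_, le_rfl⟩
    unfold groupLo
    split_ifs with h
    · exact Nat.zero_le _
    · have h1 := hr (j - 1) (by omega)
      rw [Nat.sub_add_cancel (by omega)] at h1
      exact h1
  have hne : ∀ j, Nonempty {i // g i = j} := fun j => ⟨⟨_, (hsurj j).choose_spec⟩⟩
  have hβ : ∀ j, 0 < groupMap n ℓ r α j := by
    intro j
    rw [hmap]
    exact Finset.sum_pos (fun i _ => hα _) Finset.univ_nonempty
  have hmeas : Measurable (groupMap n ℓ r) := by
    have : groupMap n ℓ r = fun x j => ∑ i : {i // g i = j}, x i := funext hmap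
    rw [this]; fun_prop
  have hG : (prodGamma α).map (groupMap n ℓ r) = prodGamma (groupMap n ℓ r α) := by
    have : groupMap n ℓ r = fun x j => ∑ i : {i // g i = j}, x i := funext hmap
    rw [this]
    exact prodGamma_group g hsurj α hα
  rw [dirichlet_eq_map n α hα, dirichlet_eq_map ℓ _ hβ, ← hG, Measure.map_map hmeas (by fun_prop),
    Measure.map_map (by fun_prop) hmeas]
  congr 1
  ext y j
  have hs : ∑ j, groupMap n ℓ r y j = ∑ i, y i := by
    rw [hmap]
    exact Fintype.sum_fiberwise g y
  simp only [Function.comp, hs]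
  simp only [hmap, Pi.smul_apply, smul_eq_mul, Finset.mul_sum]
end
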